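/- Let Γ be a finite group, n ≥ 1, and π = π_{ℓ1} ⊗̂ ⋯ ⊗̂ π_{ℓn} an irreducible representation of Γ^n with stabilizer S_π in S_n. If M_π(e) > Σ_{ρ ∈ Ŝ_π} dim ρ, where the sum runs over all irreducible representations of S_π, then (G_n, K_n) is not a Gelfand pair. -/

import Mathlib

noncomputable section

open CategoryTheory
open scoped TensorProduct MonoidalCategory

/-- The action of `Equiv.Perm (Fin n)` on `Fin n → Γ` permuting the factors. -/
def permHom (Γ : Type) [Group Γ] (n : ℕ) : Equiv.Perm (Fin n) →* MulAut (Fin n → Γ) where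
  toFun σ :=
    { toFun := fun f => f ∘ σ.symm
      invFun := fun f => f ∘ σ
      left_inv := fun f => by ext i; simp
      right_inv := fun f => by ext i; simp
      map_mul' := fun f g => rfl }
  map_one' := by ext f i; rfl
  map_mul' := fun σ τ => by ext f i; rfl

/-- The wreath product `Γ^n ⋊ S_n`. -/
abbrev Gn (Γ : Type) [Group Γ] (n : ℕ) := (Fin n → Γ) ⋊[permHom Γ n] Equiv.Perm (Fin n)

/-- The subgroup `K_n = Δ_n × S_n` of `G_n`, where `Δ_n` is the diagonal subgroup of `Γ^n`. -/
def Kn (Γ : Type) [Group Γ] (n : ℕ) : Subgroup (Gn Γ n) where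
  carrier := {g | ∃ γ : Γ, g.left = fun _ => γ}
  one_mem' := ⟨1, rfl⟩
  mul_mem' := by
    rintro a b ⟨γ, ha⟩ ⟨δ, hb⟩
    exact ⟨γ * δ, by simp [SemidirectProduct.mul_left, ha, hb, permHom]; rfl⟩
  inv_mem' := by
    rintro a ⟨γ, ha⟩
    exact ⟨γ⁻¹, by simp [SemidirectProduct.inv_left, ha, permHom]; rfl⟩

instance {N G : Type*} [Group N] [Group G] {φ : G →* MulAut N} [Fintype N] [Fintype G] :
    Fintype (N ⋊[φ] G) :=
  Fintype.ofEquiv (N × G)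
    { toFun := fun p => ⟨p.1, p.2⟩
      invFun := fun s => (s.left, s.right)
      left_inv := fun p => rfl
      right_inv := fun s => rfl }

/-- Convolution product on complex-valued functions on a finite group. -/
def conv {G : Type*} [Group G] [Fintype G] (f g : G → ℂ) : G → ℂ :=
  fun x => (Fintype.card G : ℂ)⁻¹ * ∑ y : G, f (x * y⁻¹) * g y

/-- A function on `G` is `K`-bi-invariant. -/
def IsBiinvariant {G : Type*} [Group G] (K : Subgroup G) (f : G → ℂ) : Prop :=
  ∀ k₁ ∈ K, ∀ k₂ ∈ K, ∀ x : G, f (k₁ * x * k₂) = f x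

/-- `(G, K)` is a Gelfand pair if the convolution algebra of `K`-bi-invariant
complex-valued functions on `G` is commutative. -/
def IsGelfandPair (G : Type*) [Group G] [Fintype G] (K : Subgroup G) : Prop :=
  ∀ f g : G → ℂ, IsBiinvariant K f → IsBiinvariant K g → conv f g = conv g f
open scoped TensorProduct MonoidalCategory

/-- The stabilizer `S_π ⊆ S_n` of the labelled family `π_{ℓ1} ⊗̂ ⋯ ⊗̂ π_{ℓn}`, i.e. the
subgroup of permutations fixing the labelling function `ℓ`. -/
def stab {n : ℕ} {S : Type} (ℓ : Fin n → S) : Subgroup (Equiv.Perm (Fin n)) where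
  carrier := {σ | ∀ i, ℓ (σ i) = ℓ i}
  one_mem' := fun _ => rfl
  mul_mem' := by
    intro a b ha hb i
    simpa [Equiv.Perm.mul_apply, hb i] using ha (b i)
  inv_mem' := by
    intro a ha i
    simpa using (ha (a⁻¹ i)).symm

/-- Transport along an equality of labels. -/
def castLEquiv {Γ S : Type} [Group Γ] (π : S → FDRep ℂ Γ) {s t : S} (h : s = t) :
    (π s : Type) ≃ₗ[ℂ] (π t : Type) := by
  subst h; exact LinearEquiv.refl ℂ (π s)

/-- The intertwining operator `ω(σ)` on `V_1 ⊗ ⋯ ⊗ V_n`, sending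
`v_1 ⊗ ⋯ ⊗ v_n` to `v_{σ⁻¹(1)} ⊗ ⋯ ⊗ v_{σ⁻¹(n)}`. -/
def permOp {Γ S : Type} [Group Γ] {n : ℕ} (π : S → FDRep ℂ Γ) (ℓ : Fin n → S)
    (σ : stab ℓ) : (⨂[ℂ] i, (π (ℓ i) : Type)) →ₗ[ℂ] ⨂[ℂ] i, (π (ℓ i) : Type) :=
  ((PiTensorProduct.reindex ℂ (fun i => (π (ℓ i) : Type)) (σ : Equiv.Perm (Fin n))).trans
    (PiTensorProduct.congr fun i =>
      castLEquiv π (((stab ℓ).inv_mem σ.2) i))).toLinearMap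

/-- The character `χ_{π∘ω}` of the representation `π ∘ ω` of `Γ^n ⋊ S_π` on
`V_1 ⊗ ⋯ ⊗ V_n`, given by `(g, σ) ↦ trace (π(g) ∘ ω(σ))`. -/
def chiPiOmega {Γ S : Type} [Group Γ] {n : ℕ} (π : S → FDRep ℂ Γ) (ℓ : Fin n → S)
    (g : Fin n → Γ) (σ : stab ℓ) : ℂ :=
  LinearMap.trace ℂ _
    ((PiTensorProduct.map fun i => (π (ℓ i)).ρ (g i)) ∘ₗ permOp π ℓ σ)

/-- The class function `M_π` on `S_π`:
`M_π(σ) = (1/|Δ_n|) Σ_{δ ∈ Δ_n} χ_{π∘ω}(δ, σ)`, where `Δ_n ≃ Γ` is the diagonal. -/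
def Mpi {Γ S : Type} [Group Γ] [Fintype Γ] {n : ℕ} (π : S → FDRep ℂ Γ) (ℓ : Fin n → S)
    (σ : stab ℓ) : ℂ :=
  (Fintype.card Γ : ℂ)⁻¹ * ∑ γ : Γ, chiPiOmega π ℓ (fun _ => γ) σ

attribute [local instance] Classical.propDecidable

/-- In a semisimple module with commutative endomorphism ring, a submodule contains every
submodule isomorphic to it. -/
theorem Submodule.le_of_linearEquiv_of_commute {A M : Type*} [Ring A] [AddCommGroup M] [Module A M]
    [IsSemisimpleModule A M] (hcomm : ∀ f g : Module.End A M, f * g = g * f)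
    {S T : Submodule A M} (φ : S ≃ₗ[A] T) : T ≤ S := by
  obtain ⟨C, hC⟩ := ComplementedLattice.exists_isCompl S
  let p : M →ₗ[A] S := S.projectionOnto C hC
  have hp (s : S) : p s = s := Submodule.projectionOnto_apply_left hC s
  intro t ht
  have h := LinearMap.congr_fun (hcomm (S.subtype ∘ₗ p) (T.subtype ∘ₗ φ.toLinearMap ∘ₗ p))
    (φ.symm ⟨t, ht⟩ : M)
  simp only [Module.End.mul_apply, LinearMap.comp_apply, hp, Submodule.subtype_apply,
    LinearEquiv.coe_coe, LinearEquiv.apply_symm_apply] at h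
  rw [← h]
  exact (p t).2

theorem Submodule.finrank_finsetSup_le {k M : Type*} [Field k] [AddCommGroup M] [Module k M]
    [FiniteDimensional k M] {I : Type*} (s : Finset I) (S : I → Submodule k M) :
    Module.finrank k ↥(s.sup S) ≤ ∑ i ∈ s, Module.finrank k (S i) := by
  classical
  induction s using Finset.induction_on with
  | empty => simp
  | insert a s ha ih =>
    rw [Finset.sup_insert, Finset.sum_insert ha]
    exact (Submodule.finrank_add_le_finrank_add_finrank _ _).trans (by gcongr)

/-- If the endomorphism ring of a finite-dimensional semisimple module is commutative, the
dimension of the module is at most the sum of the dimensions of the simple modules. -/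
theorem finrank_le_sum_of_end_commute (k A M : Type*) [Field k] [Ring A] [Algebra k A]
    [AddCommGroup M] [Module k M] [Module A M] [IsScalarTower k A M] [FiniteDimensional k M]
    [IsSemisimpleModule A M] (hcomm : ∀ f g : Module.End A M, f * g = g * f)
    {I : Type*} [Fintype I] (d : I → ℕ) (c : Submodule A M → I)
    (hiso : ∀ S T : Submodule A M, IsSimpleModule A S → IsSimpleModule A T → c S = c T →
      Nonempty (S ≃ₗ[A] T))
    (hd : ∀ S : Submodule A M, IsSimpleModule A S → Module.finrank k S = d (c S)) :
    Module.finrank k M ≤ ∑ i, d i := by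
  classical
  let simples : Set (Submodule A M) := {S | IsSimpleModule A S}
  have hinj : Set.InjOn c simples := by
    intro S hS T hT h
    obtain ⟨φ⟩ := hiso S T hS hT h
    exact le_antisymm (Submodule.le_of_linearEquiv_of_commute hcomm φ.symm)
      (Submodule.le_of_linearEquiv_of_commute hcomm φ)
  have hfin : simples.Finite := Set.Finite.of_finite_image (Set.toFinite _) hinj
  have htop : hfin.toFinset.sup (fun S => S.restrictScalars k) = ⊤ := by
    have h1 : hfin.toFinset.sup id = (⊤ : Submodule A M) := by
      rw [Finset.sup_id_eq_sSup, hfin.coe_toFinset]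
      exact IsSemisimpleModule.sSup_simples_eq_top A M
    have h2 := congrArg (Submodule.restrictScalarsLatticeHom k A M) h1
    rw [map_finset_sup, map_top] at h2
    exact h2
  calc Module.finrank k M = Module.finrank k (⊤ : Submodule k M) := finrank_top k M |>.symm
    _ ≤ ∑ S ∈ hfin.toFinset, Module.finrank k (S.restrictScalars k) := by
      rw [← htop]; exact Submodule.finrank_finsetSup_le _ _
    _ = ∑ S ∈ hfin.toFinset, d (c S) :=
      Finset.sum_congr rfl fun S hS => hd S (hfin.mem_toFinset.mp hS)
    _ = ∑ i ∈ hfin.toFinset.image c, d i := by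
      rw [Finset.sum_image]; simpa using hinj
    _ ≤ ∑ i, d i := Finset.sum_le_univ_sum_of_nonneg fun _ => Nat.zero_le _

open scoped MonoidAlgebra in
/-- A finite-dimensional simple `ℂ[H]`-module gives a simple object of `FDRep ℂ H`. -/
theorem FDRep.simple_of_ofModule' {H : Type} [Group H] [Finite H] (M : Type) [AddCommGroup M]
    [Module ℂ M] [Module ℂ[H] M] [IsScalarTower ℂ ℂ[H] M] [FiniteDimensional ℂ M]
    [IsSimpleModule ℂ[H] M] :
    Simple (FDRep.of (Representation.ofModule' (k := ℂ) (G := H) M)) := by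
  rw [FDRep.simple_iff_end_is_rank_one]
  set τ := Representation.ofModule' (k := ℂ) (G := H) M
  have hsingle (g : H) (m : M) : τ g m = MonoidAlgebra.single g (1 : ℂ) • m := by
    simp [τ, Representation.ofModule']
  have hf (f : FDRep.of τ ⟶ FDRep.of τ) (g : H) (v : M) :
      f.hom.hom.hom (MonoidAlgebra.single g (1 : ℂ) • v) =
        MonoidAlgebra.single g (1 : ℂ) • f.hom.hom.hom v := by
    rw [← hsingle, ← hsingle]
    exact ConcreteCategory.congr_hom ((forget (FGModuleCat ℂ)).congr_map (f.comm g)) v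
  have hnt : Nontrivial M := IsSimpleModule.nontrivial ℂ[H] M
  refine finrank_eq_one (𝟙 _) (fun h0 => ?_) fun f => ?_
  · obtain ⟨m, hm⟩ := exists_ne (0 : M)
    exact hm (LinearMap.congr_fun (congrArg (fun f => f.hom.hom.hom) h0) m)
  · obtain ⟨c, hc⟩ := (IsSimpleModule.algebraMap_end_bijective_of_isAlgClosed ℂ
      (A := ℂ[H]) (V := M)).2 (MonoidAlgebra.equivariantOfLinearOfComm f.hom.hom.hom (hf f))
    refine ⟨c, ?_⟩
    ext v
    exact LinearMap.congr_fun hc v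

theorem FDRep.isoToLinearEquiv_ρ {H : Type} [Group H] {V W : FDRep ℂ H} (i : V ≅ W) (h : H)
    (v : V) : FDRep.isoToLinearEquiv i (V.ρ h v) = W.ρ h (FDRep.isoToLinearEquiv i v) := by
  rw [FDRep.Iso.conj_ρ i h, LinearEquiv.conj_apply_apply, LinearEquiv.symm_apply_apply]

open scoped MonoidAlgebra in
/-- If the self-intertwiners of a representation `τ` of a finite group commute, then the dimension
of `τ` is at most the sum of the dimensions of the irreducible representations. -/
theorem finrank_le_sum_of_intertwiner_commute {H : Type} [Group H] [Finite H] {W : Type}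
    [AddCommGroup W] [Module ℂ W] [FiniteDimensional ℂ W] (τ : Representation ℂ H W)
    (hcomm : ∀ A B : W →ₗ[ℂ] W, (∀ h, A ∘ₗ τ h = τ h ∘ₗ A) → (∀ h, B ∘ₗ τ h = τ h ∘ₗ B) →
      A ∘ₗ B = B ∘ₗ A)
    {R : Type} [Fintype R] (ρ : R → FDRep ℂ H)
    (hρ : ∀ σ : FDRep ℂ H, Simple σ → ∃ r, Nonempty (σ ≅ ρ r)) :
    Module.finrank ℂ W ≤ ∑ r, Module.finrank ℂ (ρ r) := by
  classical
  let M := τ.asModule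
  have : FiniteDimensional ℂ M := inferInstanceAs (FiniteDimensional ℂ W)
  let F (S : Submodule ℂ[H] M) : FDRep ℂ H :=
    FDRep.of (Representation.ofModule' (k := ℂ) (G := H) (S.restrictScalars ℂ))
  have hF (S : Submodule ℂ[H] M) (hS : IsSimpleModule ℂ[H] S) : ∃ r, Nonempty (F S ≅ ρ r) :=
    hρ _ (have : IsSimpleModule ℂ[H] (S.restrictScalars ℂ) := hS; FDRep.simple_of_ofModule' _)
  let c (S : Submodule ℂ[H] M) : Option R :=
    if hS : IsSimpleModule ℂ[H] S then some (hF S hS).choose else none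
  have hc (S : Submodule ℂ[H] M) (hS : IsSimpleModule ℂ[H] S) :
      ∃ r, c S = some r ∧ Nonempty (F S ≅ ρ r) :=
    ⟨_, dif_pos hS, (hF S hS).choose_spec⟩
  have hend (f : Module.End ℂ[H] M) (h : H) :
      (f.restrictScalars ℂ : W →ₗ[ℂ] W) ∘ₗ τ h = τ h ∘ₗ (f.restrictScalars ℂ : W →ₗ[ℂ] W) :=
    ((Representation.IntertwiningMap.equivAlgEnd (ρ := τ)).symm f).isIntertwining' h
  have key := finrank_le_sum_of_end_commute ℂ ℂ[H] M (fun f g => by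
      ext v
      exact LinearMap.congr_fun (hcomm _ _ (hend f) (hend g)) v)
    (fun o : Option R => o.elim 0 fun r => Module.finrank ℂ (ρ r)) c
    (fun S T hS hT hST => by
      obtain ⟨r, hr, ⟨φ⟩⟩ := hc S hS
      obtain ⟨r', hr', ⟨ψ⟩⟩ := hc T hT
      obtain rfl : r = r' := by rw [hr, hr'] at hST; exact Option.some_injective _ hST
      let χ := φ ≪≫ ψ.symm
      let e : S ≃ₗ[ℂ] T := FDRep.isoToLinearEquiv χ
      have he (h : H) (s : S) : e (MonoidAlgebra.single h (1 : ℂ) • s) =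
          MonoidAlgebra.single h (1 : ℂ) • e s := by
        have h3 (S : Submodule ℂ[H] M) (s : S) :
            (F S).ρ h s = MonoidAlgebra.single h (1 : ℂ) • s := by
          change Representation.ofModule' (k := ℂ) (G := H) (S.restrictScalars ℂ) h s = _
          simp only [Representation.ofModule', MonoidAlgebra.lift_symm_apply]
          rfl
        exact (congrArg e (h3 S s)).symm.trans
          ((FDRep.isoToLinearEquiv_ρ χ h s).trans (h3 T (e s)))
      exact ⟨LinearEquiv.ofBijective
        (MonoidAlgebra.equivariantOfLinearOfComm e.toLinearMap he) e.bijective⟩)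
    (fun S hS => by
      obtain ⟨r, hr, ⟨φ⟩⟩ := hc S hS
      rw [hr]
      exact (FDRep.isoToLinearEquiv φ).finrank_eq)
  rw [Fintype.sum_option] at key
  exact key.trans_eq (Nat.zero_add _)

/-- The morphism of representations given by an equivariant linear map. -/
def FDRep.homOfEquivariant {G : Type} [Group G] {V W : FDRep ℂ G} (f : V →ₗ[ℂ] W)
    (hf : ∀ g, f ∘ₗ V.ρ g = W.ρ g ∘ₗ f) : V ⟶ W :=
  ⟨InducedCategory.homMk (ModuleCat.ofHom f), fun g => by
    ext v
    exact LinearMap.congr_fun (hf g) v⟩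

theorem FDRep.eq_zero_of_equivariant {G : Type} [Group G] {V W : FDRep ℂ G} [Simple V] [Simple W]
    (h : IsEmpty (V ≅ W)) (f : V →ₗ[ℂ] W) (hf : ∀ g, f ∘ₗ V.ρ g = W.ρ g ∘ₗ f) : f = 0 := by
  have h0 := FDRep.finrank_hom_simple_simple V W
  rw [if_neg (not_nonempty_iff.mpr h), Module.finrank_zero_iff] at h0
  have h1 := Subsingleton.elim (FDRep.homOfEquivariant f hf) 0
  exact congrArg (fun φ : V ⟶ W => φ.hom.hom.hom) h1

theorem FDRep.exists_eq_smul_id_of_equivariant {G : Type} [Group G] {V : FDRep ℂ G} [Simple V]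
    (f : V →ₗ[ℂ] V) (hf : ∀ g, f ∘ₗ V.ρ g = V.ρ g ∘ₗ f) : ∃ c : ℂ, f = c • LinearMap.id := by
  obtain ⟨c, hc⟩ := (finrank_eq_one_iff_of_nonzero' (𝟙 V) (id_nonzero V)).mp
    (finrank_endomorphism_simple_eq_one ℂ V) (FDRep.homOfEquivariant f hf)
  exact ⟨c, (congrArg (fun φ : V ⟶ V => φ.hom.hom.hom) hc).symm⟩

theorem Representation.sum_conj_equivariant {G V W : Type*} [Group G] [Fintype G]
    [AddCommGroup V] [Module ℂ V] [AddCommGroup W] [Module ℂ W] (ρ : Representation ℂ G V)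
    (σ : Representation ℂ G W) (f : V →ₗ[ℂ] W) (g : G) :
    (∑ x, σ x ∘ₗ f ∘ₗ ρ x⁻¹) ∘ₗ ρ g = σ g ∘ₗ ∑ x, σ x ∘ₗ f ∘ₗ ρ x⁻¹ := by
  ext v
  simp only [LinearMap.comp_apply, LinearMap.sum_apply, map_sum]
  refine Fintype.sum_equiv (Equiv.mulLeft g⁻¹) _ _ fun x => ?_
  simp [← Module.End.mul_apply, ← map_mul]

/-- Every rank one operator on an irreducible representation is realized by an element of the
group algebra acting as zero on all other irreducible representations. -/
theorem FDRep.exists_sum_smul_eq_smulRight {G : Type} [Group G] [Fintype G] (V : FDRep ℂ G)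
    [Simple V] (φ : V →ₗ[ℂ] ℂ) (u : V) :
    ∃ a : G → ℂ, ∑ g, a g • V.ρ g = φ.smulRight u ∧
      ∀ W : FDRep ℂ G, Simple W → IsEmpty (V ≅ W) → ∑ g, a g • W.ρ g = 0 := by
  let q : ℂ := (Module.finrank ℂ V : ℂ) * (Fintype.card G : ℂ)⁻¹
  have hsum (W : FDRep ℂ G) (v : W) : (∑ g, (q * φ (V.ρ g⁻¹ u)) • W.ρ g) v =
      q • (∑ g, W.ρ g ∘ₗ φ.smulRight v ∘ₗ V.ρ g⁻¹) u := by
    simp [LinearMap.sum_apply, Finset.smul_sum, mul_smul]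
  refine ⟨fun g => q * φ (V.ρ g⁻¹ u), ?_, fun W hW hVW => ?_⟩
  · ext v
    obtain ⟨c, hc⟩ := FDRep.exists_eq_smul_id_of_equivariant _
      (Representation.sum_conj_equivariant V.ρ V.ρ (φ.smulRight v))
    have htr := congrArg (LinearMap.trace ℂ V) hc
    have hconj (g : G) : LinearMap.trace ℂ V (V.ρ g ∘ₗ φ.smulRight v ∘ₗ V.ρ g⁻¹) = φ v := by
      rw [LinearMap.trace_comp_comm', LinearMap.comp_assoc, ← Module.End.mul_eq_comp (V.ρ g⁻¹),
        ← map_mul, inv_mul_cancel, map_one, Module.End.one_eq_id, LinearMap.comp_id,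
        LinearMap.trace_smulRight]
    simp only [map_sum, hconj, map_smul, LinearMap.trace_id, Finset.sum_const, Finset.card_univ,
      nsmul_eq_mul, smul_eq_mul] at htr
    rw [hsum, hc]
    have hcard : (Fintype.card G : ℂ) ≠ 0 := by simp
    have : q * c = φ v := by
      simp only [q]
      field_simp
      linear_combination -htr
    simp [smul_smul, this]
  · ext v
    rw [hsum, FDRep.eq_zero_of_equivariant hVW _ (Representation.sum_conj_equivariant V.ρ W.ρ _)]
    simp

section TensorRep

variable {Γ S : Type} [Group Γ] {n : ℕ} (π : S → FDRep ℂ Γ) (ℓ : Fin n → S)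

theorem castLEquiv_castLEquiv {s t u : S} (h : s = t) (h' : t = u) (v : π s) :
    castLEquiv π h' (castLEquiv π h v) = castLEquiv π (h.trans h') v := by
  subst h h'; rfl

theorem castLEquiv_ρ {s t : S} (h : s = t) (g : Γ) (v : π s) :
    castLEquiv π h ((π s).ρ g v) = (π t).ρ g (castLEquiv π h v) := by
  subst h; rfl

/-- The exterior tensor product representation of `Γ^n`. -/
def tensorRep : Representation ℂ (Fin n → Γ) (⨂[ℂ] i, (π (ℓ i) : Type)) where
  toFun g := PiTensorProduct.map fun i => (π (ℓ i)).ρ (g i)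
  map_one' := by simp [PiTensorProduct.map_one]
  map_mul' g h := by simp [PiTensorProduct.map_mul]

theorem tensorRep_tprod (g : Fin n → Γ) (v : ∀ i, π (ℓ i)) :
    tensorRep π ℓ g (PiTensorProduct.tprod ℂ v) =
      PiTensorProduct.tprod ℂ fun i => (π (ℓ i)).ρ (g i) (v i) :=
  PiTensorProduct.map_tprod _ _

theorem permOp_tprod (σ : stab ℓ) (v : ∀ i, π (ℓ i)) :
    permOp π ℓ σ (PiTensorProduct.tprod ℂ v) =
      PiTensorProduct.tprod ℂ fun i =>
        castLEquiv π ((stab ℓ).inv_mem σ.2 i) (v ((σ : Equiv.Perm (Fin n))⁻¹ i)) := by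
  simp only [permOp, LinearEquiv.coe_coe, LinearEquiv.trans_apply, PiTensorProduct.reindex_tprod]
  exact PiTensorProduct.congr_tprod _ _

/-- The intertwining representation `ω` of `S_π`. -/
def permRep : Representation ℂ (stab ℓ) (⨂[ℂ] i, (π (ℓ i) : Type)) where
  toFun σ := permOp π ℓ σ
  map_one' := by
    ext v
    simp only [LinearMap.compMultilinearMap_apply, permOp_tprod]
    rfl
  map_mul' σ τ := by
    ext v
    simp only [LinearMap.compMultilinearMap_apply, permOp_tprod, Module.End.mul_apply,
      castLEquiv_castLEquiv]
    congr 1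

theorem permRep_comp_tensorRep (σ : stab ℓ) (g : Fin n → Γ) :
    permRep π ℓ σ * tensorRep π ℓ g =
      tensorRep π ℓ (g ∘ (σ : Equiv.Perm (Fin n)).symm) * permRep π ℓ σ := by
  ext v
  simp only [LinearMap.compMultilinearMap_apply, Module.End.mul_apply, permRep,
    MonoidHom.coe_mk, OneHom.coe_mk, permOp_tprod, tensorRep_tprod, castLEquiv_ρ]
  rfl

/-- Linear operators on a tensor product are spanned by tensor products of rank one operators. -/
theorem PiTensorProduct.span_map_smulRight {ι : Type*} [Fintype ι] {V : ι → Type*}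
    [∀ i, AddCommGroup (V i)] [∀ i, Module ℂ (V i)] [∀ i, FiniteDimensional ℂ (V i)] :
    Submodule.span ℂ {A : Module.End ℂ (⨂[ℂ] i, V i) | ∃ (φ : ∀ i, V i →ₗ[ℂ] ℂ) (u : ∀ i, V i),
      A = PiTensorProduct.map fun i => (φ i).smulRight (u i)} = ⊤ := by
  classical
  let b := Basis.piTensorProduct fun i => Module.finBasis ℂ (V i)
  rw [eq_top_iff, ← (Module.Basis.linearMap b b).span_eq]
  refine Submodule.span_mono ?_
  rintro _ ⟨⟨p, q⟩, rfl⟩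
  refine ⟨fun i => (Module.finBasis ℂ (V i)).coord (q i), fun i => Module.finBasis ℂ (V i) (p i), ?_⟩
  refine b.ext fun r => ?_
  rw [Module.Basis.linearMap_apply_apply]
  simp only [b, Basis.piTensorProduct_apply, PiTensorProduct.map_tprod, LinearMap.smulRight_apply,
    Module.Basis.coord_apply, Module.Basis.repr_self]
  rw [MultilinearMap.map_smul_univ]
  simp [Finsupp.single_apply, Finset.prod_ite_zero, funext_iff, eq_comm]

theorem sum_prod_smul_map {ι G : Type*} [Fintype ι] [DecidableEq ι] [Fintype G] {V : ι → Type*}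
    [∀ i, AddCommGroup (V i)] [∀ i, Module ℂ (V i)] (a : ι → G → ℂ)
    (ρ : ∀ i, G → Module.End ℂ (V i)) :
    ∑ g : ι → G, (∏ i, a i (g i)) • PiTensorProduct.map (fun i => ρ i (g i)) =
      PiTensorProduct.map fun i => ∑ g, a i g • ρ i g := by
  have h := (PiTensorProduct.mapMultilinear ℂ V V).map_sum fun i (g : G) => a i g • ρ i g
  simp only [MultilinearMap.map_smul_univ] at h
  exact h.symm

variable [Fintype Γ]

/-- Every operator on the exterior tensor product is realized by an element of the group algebra
of `Γ^n` acting as zero on the non-isomorphic conjugates. -/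
theorem exists_sum_smul_tensorRep_eq (hsimple : ∀ s, Simple (π s))
    (hdistinct : ∀ s t : S, Nonempty (π s ≅ π t) → s = t)
    (A : Module.End ℂ (⨂[ℂ] i, (π (ℓ i) : Type))) :
    ∃ a : (Fin n → Γ) → ℂ, ∑ g, a g • tensorRep π ℓ g = A ∧
      ∀ σ : Equiv.Perm (Fin n), σ ∉ stab ℓ → ∑ g, a (g ∘ σ) • tensorRep π ℓ g = 0 := by
  have hA : A ∈ Submodule.span ℂ _ :=
    PiTensorProduct.span_map_smulRight (V := fun i => (π (ℓ i) : Type)).ge Submodule.mem_top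
  induction hA using Submodule.span_induction with
  | mem A hA =>
    obtain ⟨φ, u, rfl⟩ := hA
    choose a ha ha' using fun i => FDRep.exists_sum_smul_eq_smulRight (π (ℓ i)) (φ i) (u i)
    refine ⟨fun g => ∏ i, a i (g i), ?_, fun σ hσ => ?_⟩
    · simp_rw [← ha]
      exact sum_prod_smul_map a fun i g => (π (ℓ i)).ρ g
    · obtain ⟨i, hi⟩ : ∃ i, ℓ (σ i) ≠ ℓ i := not_forall.mp hσ
      have h1 (g : Fin n → Γ) : ∏ i, a i ((g ∘ σ) i) = ∏ i, a (σ.symm i) (g i) :=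
        Fintype.prod_equiv σ _ _ fun i => by simp
      simp_rw [h1]
      refine (sum_prod_smul_map (fun i => a (σ.symm i)) fun i g => (π (ℓ i)).ρ g).trans ?_
      refine (PiTensorProduct.mapMultilinear ℂ _ _).map_coord_zero (σ i) ?_
      refine ha' _ _ (hsimple _) ⟨fun e => hi ?_⟩
      rw [σ.symm_apply_apply] at e
      exact (hdistinct _ _ ⟨e⟩).symm
  | zero => exact ⟨0, by simp⟩
  | add A B _ _ hA hB =>
    obtain ⟨a, ha, ha'⟩ := hA
    obtain ⟨b, hb, hb'⟩ := hB
    refine ⟨a + b, ?_, fun σ hσ => ?_⟩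
    · simp [add_smul, Finset.sum_add_distrib, ha, hb]
    · simp [add_smul, Finset.sum_add_distrib, ha' σ hσ, hb' σ hσ]
  | smul c A _ hA =>
    obtain ⟨a, ha, ha'⟩ := hA
    refine ⟨c • a, ?_, fun σ hσ => ?_⟩
    · simp [mul_smul, ← Finset.smul_sum, ha]
    · simp [mul_smul, ← Finset.smul_sum, ha' σ hσ]

end TensorRep

section Gelfand

variable {Γ : Type} [Group Γ] {n : ℕ}

/-- A function on `Γ^n` invariant under two-sided diagonal translations and permutations extends
to a `K_n`-bi-invariant function on `G_n`. -/
theorem isBiinvariant_comp_left {a : (Fin n → Γ) → ℂ}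
    (ha : ∀ (γ δ : Γ) (σ : Equiv.Perm (Fin n)) (g : Fin n → Γ),
      a (fun i => γ * g (σ i) * δ) = a g) :
    IsBiinvariant (Kn Γ n) fun x : Gn Γ n => a x.left := by
  rintro k₁ ⟨γ, hγ⟩ k₂ ⟨δ, hδ⟩ x
  refine Eq.trans (congrArg a ?_) (ha γ δ k₁.right.symm x.left)
  ext i
  simp [SemidirectProduct.mul_left, hγ, hδ, permHom]

variable [Fintype Γ]

theorem conv_comp_left {a b : (Fin n → Γ) → ℂ}
    (hb : ∀ (σ : Equiv.Perm (Fin n)) (g : Fin n → Γ), b (g ∘ σ) = b g) (g : Fin n → Γ) :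
    conv (fun x : Gn Γ n => a x.left) (fun x => b x.left) ⟨g, 1⟩ =
      (Fintype.card (Gn Γ n) : ℂ)⁻¹ *
        ((Fintype.card (Equiv.Perm (Fin n)) : ℂ) * ∑ h, a (g * h⁻¹) * b h) := by
  rw [conv]
  congr 1
  let e : Gn Γ n ≃ Equiv.Perm (Fin n) × (Fin n → Γ) :=
    { toFun := fun x => (x.right, x.left ∘ x.right)
      invFun := fun p => ⟨p.2 ∘ p.1.symm, p.1⟩
      left_inv := fun x => by
        ext i <;> simp
      right_inv := fun p => by
        ext i <;> simp }
  have h (x : Gn Γ n) : a ((⟨g, 1⟩ : Gn Γ n) * x⁻¹).left * b x.left =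
      a (g * (e x).2⁻¹) * b (e x).2 := by
    change _ = a (g * (x.left ∘ x.right)⁻¹) * b (x.left ∘ x.right)
    rw [hb]
    congr 2
  simp_rw [h]
  rw [Fintype.sum_equiv e _ (fun p => a (g * p.2⁻¹) * b p.2) fun _ => rfl, Fintype.sum_prod_type]
  simp

theorem sum_smul_mul_sum_smul {N V : Type*} [Group N] [Fintype N] [AddCommGroup V] [Module ℂ V]
    (ρ : Representation ℂ N V) (a b : N → ℂ) :
    (∑ g, a g • ρ g) * ∑ g, b g • ρ g = ∑ g, (∑ h, a (g * h⁻¹) * b h) • ρ g := by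
  simp_rw [Finset.sum_mul_sum, Finset.sum_smul]
  refine Finset.sum_comm.trans (Eq.trans ?_ Finset.sum_comm)
  refine Finset.sum_congr rfl fun h _ => ?_
  refine Fintype.sum_equiv (Equiv.mulRight h) _ _ fun g => ?_
  simp [smul_smul, mul_comm (b h)]

/-- If `(G_n, K_n)` is a Gelfand pair, then invariant functions on `Γ^n` act by commuting
operators in every representation of `Γ^n`. -/
theorem IsGelfandPair.sum_smul_commute (hG : IsGelfandPair (Gn Γ n) (Kn Γ n)) {V : Type*}
    [AddCommGroup V] [Module ℂ V] (ρ : Representation ℂ (Fin n → Γ) V) {a b : (Fin n → Γ) → ℂ}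
    (ha : ∀ (γ δ : Γ) (σ : Equiv.Perm (Fin n)) (g : Fin n → Γ),
      a (fun i => γ * g (σ i) * δ) = a g)
    (hb : ∀ (γ δ : Γ) (σ : Equiv.Perm (Fin n)) (g : Fin n → Γ),
      b (fun i => γ * g (σ i) * δ) = b g) :
    (∑ g, a g • ρ g) * ∑ g, b g • ρ g = (∑ g, b g • ρ g) * ∑ g, a g • ρ g := by
  rw [sum_smul_mul_sum_smul, sum_smul_mul_sum_smul]
  refine Finset.sum_congr rfl fun g _ => ?_
  have h := congrFun (hG _ _ (isBiinvariant_comp_left ha) (isBiinvariant_comp_left hb)) ⟨g, 1⟩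
  rw [conv_comp_left fun σ g => by simpa [Function.comp_def] using hb 1 1 σ g,
    conv_comp_left fun σ g => by simpa [Function.comp_def] using ha 1 1 σ g] at h
  have hcard : (Fintype.card (Gn Γ n) : ℂ)⁻¹ ≠ 0 := by simp
  have hperm : (Fintype.card (Equiv.Perm (Fin n)) : ℂ) ≠ 0 := by simp
  rw [mul_left_cancel₀ hperm (mul_left_cancel₀ hcard h)]

end Gelfand

section Main

variable {Γ S : Type} [Group Γ] {n : ℕ} (π : S → FDRep ℂ Γ) (ℓ : Fin n → S)

/-- The restriction of the exterior tensor product to the diagonal. -/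
def diagRep : Representation ℂ Γ (⨂[ℂ] i, (π (ℓ i) : Type)) :=
  (tensorRep π ℓ).comp (Pi.constMonoidHom (Fin n) Γ)

theorem diagRep_apply (γ : Γ) : diagRep π ℓ γ = tensorRep π ℓ fun _ => γ := rfl

theorem permRep_mul_diagRep (σ : stab ℓ) (γ : Γ) :
    permRep π ℓ σ * diagRep π ℓ γ = diagRep π ℓ γ * permRep π ℓ σ :=
  permRep_comp_tensorRep π ℓ σ _

variable [Fintype Γ]

/-- An operator commuting with `S_π` and absorbing the diagonal is realized, up to a non-zero
scalar, by an invariant function on `Γ^n`. -/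
theorem exists_invariant_sum_smul_tensorRep_eq (hsimple : ∀ s, Simple (π s))
    (hdistinct : ∀ s t : S, Nonempty (π s ≅ π t) → s = t)
    (A : Module.End ℂ (⨂[ℂ] i, (π (ℓ i) : Type)))
    (hperm : ∀ σ, permRep π ℓ σ * A = A * permRep π ℓ σ)
    (hleft : ∀ γ, diagRep π ℓ γ * A = A) (hright : ∀ γ, A * diagRep π ℓ γ = A) :
    ∃ (b : (Fin n → Γ) → ℂ) (c : ℂ), c ≠ 0 ∧ ∑ g, b g • tensorRep π ℓ g = c • A ∧
      ∀ (γ δ : Γ) (σ : Equiv.Perm (Fin n)) (g : Fin n → Γ),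
        b (fun i => γ * g (σ i) * δ) = b g := by
  obtain ⟨a, ha, ha'⟩ := exists_sum_smul_tensorRep_eq π ℓ hsimple hdistinct A
  have hconj (σ : Equiv.Perm (Fin n)) :
      ∑ g, a (g ∘ σ) • tensorRep π ℓ g = if σ ∈ stab ℓ then A else 0 := by
    split_ifs with hσ
    · have h (g : Fin n → Γ) : tensorRep π ℓ g = permRep π ℓ ⟨σ, hσ⟩ *
          tensorRep π ℓ (g ∘ σ) * permRep π ℓ ⟨σ, hσ⟩⁻¹ := by
        rw [permRep_comp_tensorRep, mul_assoc, ← map_mul, mul_inv_cancel, map_one, mul_one]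
        congr 1
        ext i
        simp
      calc ∑ g, a (g ∘ σ) • tensorRep π ℓ g
          = ∑ g : Fin n → Γ, permRep π ℓ ⟨σ, hσ⟩ * (a (g ∘ σ) • tensorRep π ℓ (g ∘ σ)) *
              permRep π ℓ ⟨σ, hσ⟩⁻¹ := by
            refine Finset.sum_congr rfl fun g _ => ?_
            rw [h g]
            simp
        _ = permRep π ℓ ⟨σ, hσ⟩ * (∑ g, a g • tensorRep π ℓ g) * permRep π ℓ ⟨σ, hσ⟩⁻¹ := by
            rw [← Finset.sum_mul, ← Finset.mul_sum]
            congr 2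
            exact Fintype.sum_equiv (σ.symm.arrowCongr (Equiv.refl Γ)) _ _ fun g => rfl
        _ = A := by
            rw [ha, hperm, mul_assoc, ← map_mul, mul_inv_cancel, map_one, mul_one]
    · exact ha' σ hσ
  have htrans (σ : Equiv.Perm (Fin n)) (γ δ : Γ) :
      ∑ g : Fin n → Γ, a (fun i => γ * g (σ i) * δ) • tensorRep π ℓ g =
        if σ ∈ stab ℓ then A else 0 := by
    calc ∑ g : Fin n → Γ, a (fun i => γ * g (σ i) * δ) • tensorRep π ℓ g
        = ∑ g : Fin n → Γ, diagRep π ℓ γ⁻¹ * (a (g ∘ σ) • tensorRep π ℓ g) * diagRep π ℓ δ⁻¹ := by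
          refine Fintype.sum_equiv
            ((Equiv.mulLeft fun _ => γ).trans (Equiv.mulRight fun _ => δ)) _ _ fun g => ?_
          simp only [diagRep_apply, mul_smul_comm, smul_mul_assoc, ← map_mul]
          congr 2
          ext i
          simp [mul_assoc]
      _ = diagRep π ℓ γ⁻¹ * (∑ g, a (g ∘ σ) • tensorRep π ℓ g) * diagRep π ℓ δ⁻¹ := by
          rw [Finset.mul_sum, Finset.sum_mul]
      _ = if σ ∈ stab ℓ then A else 0 := by
          rw [hconj]
          split_ifs
          · rw [hleft, hright]
          · simp
  refine ⟨fun g => ∑ σ : Equiv.Perm (Fin n), ∑ γ : Γ, ∑ δ : Γ, a (fun i => γ * g (σ i) * δ),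
    ∑ σ : Equiv.Perm (Fin n), ∑ _γ : Γ, ∑ _δ : Γ, if σ ∈ stab ℓ then 1 else 0, ?_, ?_, ?_⟩
  · have h : ((Finset.univ.filter fun σ => σ ∈ stab ℓ).card : ℂ) ≠ 0 := by
      rw [Nat.cast_ne_zero, Finset.card_ne_zero]
      exact ⟨1, by simp [one_mem]⟩
    simp only [Finset.sum_const, ← Finset.smul_sum, Finset.sum_boole, Finset.card_univ]
    simpa using h
  · simp_rw [Finset.sum_smul]
    rw [Finset.sum_comm]
    refine Finset.sum_congr rfl fun σ _ => ?_
    rw [Finset.sum_comm]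
    refine Finset.sum_congr rfl fun γ _ => ?_
    rw [Finset.sum_comm]
    refine Finset.sum_congr rfl fun δ _ => ?_
    rw [htrans, ite_smul, one_smul, zero_smul]
  · intro γ₀ δ₀ σ₀ g
    refine Fintype.sum_equiv (Equiv.mulLeft σ₀) _ _ fun σ => ?_
    refine Fintype.sum_equiv (Equiv.mulRight γ₀) _ _ fun γ => ?_
    refine Fintype.sum_equiv (Equiv.mulLeft δ₀) _ _ fun δ => ?_
    simp [mul_assoc]

theorem Mpi_one_eq_finrank :
    Mpi π ℓ 1 = Module.finrank ℂ (diagRep π ℓ).invariants := by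
  have : Invertible (Nat.card Γ : ℂ) := invertibleOfNonzero (by simp)
  rw [← Representation.card_inv_mul_sum_char_eq_finrank, Mpi, Nat.card_eq_fintype_card]
  congr 1
  refine Finset.sum_congr rfl fun γ _ => ?_
  have h : permOp π ℓ 1 = LinearMap.id := map_one (permRep π ℓ)
  rw [chiPiOmega, h, LinearMap.comp_id]
  rfl

/-- The representation of `S_π` on the invariants of the diagonal. -/
def invariantsRep : Representation ℂ (stab ℓ) (diagRep π ℓ).invariants where
  toFun σ := (permRep π ℓ σ).restrict fun w hw γ => by
    rw [← Module.End.mul_apply, ← permRep_mul_diagRep, Module.End.mul_apply, hw γ]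
  map_one' := by ext; simp
  map_mul' σ τ := by
    ext w
    exact LinearMap.congr_fun (map_mul (permRep π ℓ) σ τ) w

/-- If `(G_n, K_n)` is a Gelfand pair, then the self-intertwiners of the representation of `S_π`
on the invariants of the diagonal commute. -/
theorem IsGelfandPair.invariantsRep_intertwiner_commute
    (hG : IsGelfandPair (Gn Γ n) (Kn Γ n)) (hsimple : ∀ s, Simple (π s))
    (hdistinct : ∀ s t : S, Nonempty (π s ≅ π t) → s = t)
    (A B : (diagRep π ℓ).invariants →ₗ[ℂ] (diagRep π ℓ).invariants)
    (hA : ∀ σ, A ∘ₗ invariantsRep π ℓ σ = invariantsRep π ℓ σ ∘ₗ A)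
    (hB : ∀ σ, B ∘ₗ invariantsRep π ℓ σ = invariantsRep π ℓ σ ∘ₗ B) : A ∘ₗ B = B ∘ₗ A := by
  let q : ℂ := (Fintype.card Γ : ℂ)⁻¹
  have hq : q * (Fintype.card Γ : ℂ) = 1 := inv_mul_cancel₀ (by simp)
  let e : (⨂[ℂ] i, (π (ℓ i) : Type)) →ₗ[ℂ] (diagRep π ℓ).invariants :=
    (q • ∑ γ, diagRep π ℓ γ).codRestrict _ fun w γ => by
      simp only [LinearMap.smul_apply, LinearMap.sum_apply, map_smul, map_sum]
      congr 1
      refine Fintype.sum_equiv (Equiv.mulLeft γ) _ _ fun δ => ?_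
      simp
  have he (w) : (e w : ⨂[ℂ] i, (π (ℓ i) : Type)) = q • ∑ γ, diagRep π ℓ γ w := by
    change (q • ∑ γ, diagRep π ℓ γ) w = _
    rw [LinearMap.smul_apply, LinearMap.sum_apply]
  have he_inv (u : (diagRep π ℓ).invariants) : e u = u := by
    ext
    rw [he, Finset.sum_congr rfl fun γ _ => u.2 γ]
    rw [Finset.sum_const, Finset.card_univ, ← Nat.cast_smul_eq_nsmul ℂ, smul_smul, hq, one_smul]
  have he_diag (γ) (w) : e (diagRep π ℓ γ w) = e w := by
    ext
    rw [he, he]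
    congr 1
    refine Fintype.sum_equiv (Equiv.mulRight γ) _ _ fun δ => ?_
    simp
  have he_perm (σ) (w) : e (permRep π ℓ σ w) = invariantsRep π ℓ σ (e w) := by
    ext
    change _ = permRep π ℓ σ (e w)
    rw [he, he, map_smul, map_sum]
    congr 1
    refine Finset.sum_congr rfl fun γ _ => ?_
    rw [← Module.End.mul_apply, ← permRep_mul_diagRep, Module.End.mul_apply]
  let ext' (C : (diagRep π ℓ).invariants →ₗ[ℂ] (diagRep π ℓ).invariants) :
      Module.End ℂ (⨂[ℂ] i, (π (ℓ i) : Type)) := (diagRep π ℓ).invariants.subtype ∘ₗ C ∘ₗ e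
  have hext (C : (diagRep π ℓ).invariants →ₗ[ℂ] (diagRep π ℓ).invariants)
      (hC : ∀ σ, C ∘ₗ invariantsRep π ℓ σ = invariantsRep π ℓ σ ∘ₗ C) :=
    exists_invariant_sum_smul_tensorRep_eq π ℓ hsimple hdistinct (ext' C)
      (fun σ => by
        refine LinearMap.ext fun w => ?_
        change permRep π ℓ σ (C (e w)) = C (e (permRep π ℓ σ w))
        rw [he_perm]
        exact congrArg Subtype.val (LinearMap.congr_fun (hC σ) (e w)).symm)
      (fun γ => LinearMap.ext fun w => (C (e w)).2 γ)
      (fun γ => LinearMap.ext fun w => congrArg (fun u => (C u).1) (he_diag γ w))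
  obtain ⟨a, c, hc, hac, ha⟩ := hext A hA
  obtain ⟨b, d, hd, hbd, hb⟩ := hext B hB
  have h := hG.sum_smul_commute (tensorRep π ℓ) ha hb
  rw [hac, hbd, smul_mul_smul_comm, smul_mul_smul_comm, mul_comm d c] at h
  have h' := smul_right_injective _ (mul_ne_zero hc hd) h
  ext u
  have h'' := LinearMap.congr_fun h' (u : ⨂[ℂ] i, (π (ℓ i) : Type))
  change (A (e (B (e u)))).1 = (B (e (A (e u)))).1 at h''
  rw [he_inv, he_inv, he_inv] at h''
  exact h''

end Main

/-- If `M_π(e)` exceeds the sum of the dimensions of the irreducible representations of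
`S_π` (given by a complete family `{ρ_r}_{r : R}` of pairwise non-isomorphic irreducible
representations of `S_π`), then `(G_n, K_n)` is not a Gelfand pair. -/
theorem not_isGelfandPair_of_sum_dim_lt_Mpi_one {Γ S : Type} [Group Γ] [Fintype Γ]
    (n : ℕ) (hn : 1 ≤ n)
    (π : S → FDRep ℂ Γ) (hsimple : ∀ s, Simple (π s))
    (hdistinct : ∀ s t : S, Nonempty (π s ≅ π t) → s = t)
    (ℓ : Fin n → S)
    (R : Type) [Fintype R] (ρ : R → FDRep ℂ (stab ℓ))
    (hρsimple : ∀ r, Simple (ρ r))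
    (hρdistinct : ∀ r r' : R, Nonempty (ρ r ≅ ρ r') → r = r')
    (hρcomplete : ∀ τ : FDRep ℂ (stab ℓ), Simple τ → ∃ r, Nonempty (τ ≅ ρ r))
    (hgt : ((∑ r : R, Module.finrank ℂ (ρ r) : ℕ) : ℝ) < (Mpi π ℓ 1).re) :
    ¬ IsGelfandPair (Gn Γ n) (Kn Γ n) := by
  intro hG
  have hle := finrank_le_sum_of_intertwiner_commute (invariantsRep π ℓ)
    (hG.invariantsRep_intertwiner_commute π ℓ hsimple hdistinct) ρ hρcomplete
  rw [Mpi_one_eq_finrank, Complex.natCast_re, Nat.cast_lt] at hgt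
  exact absurd hle hgt.not_ge
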